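/- arXiv:1808.06157 — 2 statements merged into one kernel-verified Lean document; each statement's English description precedes it below -/
import Mathlib

section
/- Let n ≥ 3 and q ≥ 2 be integers, let α = log log(16n)·√(log n), let c be a real number with c ≥ 640/log log(16n), and let t = (n²/(4(1−cos(2π/q))))·log n + (n²/(1−cos(2π/q)))·c·α·log q. Then Σ_y (1 − (1−cos(2π/q))·N(y)/C(n,2)²)^{2t} ≤ q^{−2c}/2, where the sum is taken over all nonzero (n−1)×(n−1) matrices y over ℤ/qℤ with N(y) ≤ C(n,2)²/(1−cos(2π/q)), C(n,2) = n(n−1)/2, and the power with real exponent 2t is the real power of the nonnegative base. -/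
/-- `Σ_{h=i}^{j} u_h` (1-based indices) for a vector `u`. -/
def isum {m q : ℕ} (u : Fin m → ZMod q) (i j : ℕ) : ZMod q :=
  ∑ a ∈ Finset.univ.filter (fun a : Fin m => i ≤ (a : ℕ) + 1 ∧ (a : ℕ) + 1 ≤ j), u a

/-- `S(u)`: the number of nonzero intervals of `u` (1-based intervals `[i,j] ⊆ [1,m]`). -/
def nzIntervals {m q : ℕ} (u : Fin m → ZMod q) : ℕ :=
  ((Finset.Icc 1 m ×ˢ Finset.Icc 1 m).filter
    (fun p => p.1 ≤ p.2 ∧ isum u p.1 p.2 ≠ 0)).card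

/-- The sum of the entries of `y` over the box `[i,j] × [k,l]` (1-based indices). -/
def bsum {m q : ℕ} (y : Matrix (Fin m) (Fin m) (ZMod q)) (i j k l : ℕ) : ZMod q :=
  ∑ a ∈ Finset.univ.filter (fun a : Fin m => i ≤ (a : ℕ) + 1 ∧ (a : ℕ) + 1 ≤ j),
    ∑ c ∈ Finset.univ.filter (fun c : Fin m => k ≤ (c : ℕ) + 1 ∧ (c : ℕ) + 1 ≤ l), y a c

/-- `N(y)`: the number of nonzero boxes of `y`. -/
def Nboxes {m q : ℕ} (y : Matrix (Fin m) (Fin m) (ZMod q)) : ℕ :=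
  (((Finset.Icc 1 m ×ˢ Finset.Icc 1 m) ×ˢ (Finset.Icc 1 m ×ˢ Finset.Icc 1 m)).filter
    (fun p => p.1.1 ≤ p.1.2 ∧ p.2.1 ≤ p.2.2 ∧ bsum y p.1.1 p.1.2 p.2.1 p.2.2 ≠ 0)).card

/-- The alternating sum of `F` over the corners of the rectangle `{i, j} × {k, l}`. -/
def cornerSum {ι κ G : Type*} [AddCommGroup G] (F : ι → κ → G) (i j : ι) (k l : κ) : G :=
  F j l - F i l - F j k + F i k

/-- The number of quadruples with nonzero corner sum. -/
def cornerCount {ι κ G : Type*} [AddCommGroup G] [DecidableEq G] [Fintype ι] [Fintype κ]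
    (F : ι → κ → G) : ℕ :=
  ∑ i, ∑ j, ∑ k, ∑ l, if cornerSum F i j k l ≠ 0 then 1 else 0

/-- The number of ordered pairs of indices at which `v` takes distinct values. -/
def diffCount {κ G : Type*} [DecidableEq G] [Fintype κ] (v : κ → G) : ℕ :=
  ∑ k, ∑ l, if v k ≠ v l then 1 else 0

/-- The two-dimensional partial sums of `y`. -/
def partialSum {m q : ℕ} (n : ℕ) (y : Matrix (Fin m) (Fin m) (ZMod q)) (i k : Fin n) : ZMod q :=
  bsum y 1 i 1 k

theorem bsum_eq_sum_ite {m q : ℕ} (y : Matrix (Fin m) (Fin m) (ZMod q)) (i j k l : ℕ) :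
    bsum y i j k l = ∑ a : Fin m, ∑ c : Fin m,
      if (i ≤ (a : ℕ) + 1 ∧ (a : ℕ) + 1 ≤ j) ∧ (k ≤ (c : ℕ) + 1 ∧ (c : ℕ) + 1 ≤ l)
        then y a c else 0 := by
  unfold bsum
  rw [Finset.sum_filter]
  refine Finset.sum_congr rfl fun a _ => ?_
  split_ifs with h
  · simp [Finset.sum_filter, h]
  · simp only [h, false_and, if_false, Finset.sum_const_zero]

theorem cornerSum_partialSum {m q n : ℕ} (y : Matrix (Fin m) (Fin m) (ZMod q))
    {i j k l : Fin n} (hij : i ≤ j) (hkl : k ≤ l) :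
    cornerSum (partialSum n y) i j k l = bsum y (i + 1) j (k + 1) l := by
  have h1 : (i : ℕ) ≤ j := hij
  have h2 : (k : ℕ) ≤ l := hkl
  unfold cornerSum partialSum
  simp only [bsum_eq_sum_ite]
  simp only [← Finset.sum_sub_distrib, ← Finset.sum_add_distrib]
  refine Finset.sum_congr rfl fun a _ => Finset.sum_congr rfl fun c _ => ?_
  by_cases ha : (a : ℕ) + 1 ≤ i <;> by_cases ha' : (a : ℕ) + 1 ≤ j <;>
    by_cases hc : (c : ℕ) + 1 ≤ k <;> by_cases hc' : (c : ℕ) + 1 ≤ l <;>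
    first
    | omega
    | simp [ha, ha', hc, hc']
      try omega

theorem bsum_singleton {m q : ℕ} (y : Matrix (Fin m) (Fin m) (ZMod q)) (a c : Fin m) :
    bsum y (a + 1) (a + 1) (c + 1) (c + 1) = y a c := by
  have h (b : Fin m) : Finset.univ.filter
      (fun x : Fin m => (b : ℕ) + 1 ≤ (x : ℕ) + 1 ∧ (x : ℕ) + 1 ≤ (b : ℕ) + 1) = {b} := by
    ext x
    simp [Fin.ext_iff]
    omega
  simp only [bsum, h, Finset.sum_singleton]

theorem cornerSum_partialSum_injective {m q n : ℕ} (hmn : m + 1 = n) :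
    Function.Injective (fun y : Matrix (Fin m) (Fin m) (ZMod q) =>
      cornerSum (partialSum n y)) := by
  intro y z hyz
  ext a c
  have key (w : Matrix (Fin m) (Fin m) (ZMod q)) :
      cornerSum (partialSum n w) ⟨a, by omega⟩ ⟨a + 1, by omega⟩ ⟨c, by omega⟩
        ⟨c + 1, by omega⟩ = w a c := by
    rw [cornerSum_partialSum w (by simp [Fin.le_def]) (by simp [Fin.le_def])]
    exact bsum_singleton w a c
  rw [← key y, ← key z]
  simp only at hyz
  rw [hyz]

theorem partialSum_zero {m q : ℕ} (n : ℕ) :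
    partialSum n (0 : Matrix (Fin m) (Fin m) (ZMod q)) = 0 := by
  ext i k
  simp [partialSum, bsum]

theorem cornerCount_le_four_mul_Nboxes {m q n : ℕ} (hmn : m + 1 = n)
    (y : Matrix (Fin m) (Fin m) (ZMod q)) :
    cornerCount (partialSum n y) ≤ 4 * Nboxes y := by
  classical
  have hcard : cornerCount (partialSum n y) = (Finset.univ.filter
      (fun p : (Fin n × Fin n) × (Fin n × Fin n) =>
        cornerSum (partialSum n y) p.1.1 p.1.2 p.2.1 p.2.2 ≠ 0)).card := by
    rw [Finset.card_filter]
    simp only [cornerCount, Fintype.sum_prod_type]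
  have hswap₁ (i j k l : Fin n) : cornerSum (partialSum n y) i j k l =
      -cornerSum (partialSum n y) j i k l := by
    simp only [cornerSum]; abel
  have hswap₂ (i j k l : Fin n) : cornerSum (partialSum n y) i j k l =
      -cornerSum (partialSum n y) i j l k := by
    simp only [cornerSum]; abel
  have hmin (i j k l : Fin n) (h : cornerSum (partialSum n y) i j k l ≠ 0) :
      cornerSum (partialSum n y) (min i j) (max i j) (min k l) (max k l) ≠ 0 := by
    rcases le_total i j with hij | hij <;> rcases le_total k l with hkl | hkl <;>
      simp only [min_eq_left, min_eq_right, max_eq_left, max_eq_right, hij, hkl]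
    · exact h
    · rwa [hswap₂, neg_ne_zero]
    · rwa [hswap₁, neg_ne_zero]
    · rwa [hswap₁, hswap₂, neg_neg]
  have hself₁ (i k l : Fin n) : cornerSum (partialSum n y) i i k l = 0 := by
    simp only [cornerSum]; abel
  have hself₂ (i j k : Fin n) : cornerSum (partialSum n y) i j k k = 0 := by
    simp only [cornerSum]; abel
  rw [hcard]
  have hbool : 4 * Nboxes y = (((((Finset.Icc 1 m ×ˢ Finset.Icc 1 m) ×ˢ
      (Finset.Icc 1 m ×ˢ Finset.Icc 1 m)).filter
      (fun p => p.1.1 ≤ p.1.2 ∧ p.2.1 ≤ p.2.2 ∧ bsum y p.1.1 p.1.2 p.2.1 p.2.2 ≠ 0)) ×ˢ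
      (Finset.univ : Finset (Bool × Bool)))).card := by
    rw [Finset.card_product, Nboxes, mul_comm]
    rfl
  rw [hbool]
  refine Finset.card_le_card_of_injOn
    (fun p => ((((min p.1.1 p.1.2 : Fin n) + 1, (max p.1.1 p.1.2 : Fin n)),
      ((min p.2.1 p.2.2 : Fin n) + 1, (max p.2.1 p.2.2 : Fin n))),
      (decide (p.1.1 < p.1.2), decide (p.2.1 < p.2.2)))) ?_ ?_
  · rintro ⟨⟨i, j⟩, ⟨k, l⟩⟩ hp
    simp only [Finset.coe_filter, Finset.mem_univ, true_and, Set.mem_ofPred_eq] at hp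
    have hij : i ≠ j := by rintro rfl; exact hp (hself₁ _ _ _)
    have hkl : k ≠ l := by rintro rfl; exact hp (hself₂ _ _ _)
    have h := hmin _ _ _ _ hp
    rw [cornerSum_partialSum y min_le_max min_le_max] at h
    have hij' : min i j < max i j := min_lt_max.2 hij
    have hkl' : min k l < max k l := min_lt_max.2 hkl
    have e1 := (max i j).isLt
    have e2 := (max k l).isLt
    rw [Fin.lt_def] at hij' hkl'
    simp only [Finset.coe_product, Finset.coe_filter, Set.mem_prod, Finset.mem_product,
      Finset.mem_Icc, Set.mem_ofPred_eq, Finset.coe_univ, Set.mem_univ, and_true]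
    refine ⟨⟨⟨⟨?_, ?_⟩, ?_, ?_⟩, ⟨?_, ?_⟩, ?_, ?_⟩, ?_, ?_, h⟩ <;> omega
  · rintro ⟨⟨i, j⟩, ⟨k, l⟩⟩ - ⟨⟨i', j'⟩, ⟨k', l'⟩⟩ - h
    simp only [Prod.mk.injEq, decide_eq_decide, Fin.lt_def] at h
    obtain ⟨⟨⟨h1, h2⟩, h3, h4⟩, h5, h6⟩ := h
    simp only [Prod.mk.injEq, Fin.ext_iff]
    simp only [Fin.coe_min, Fin.coe_max] at h1 h2 h3 h4
    omega

theorem sum_card_support_le {ι G : Type*} [Fintype ι] [DecidableEq ι] [Fintype G]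
    [DecidableEq G] [Zero G] (g : ℕ → ℝ) (hg : ∀ d, 0 ≤ g d) :
    ∑ u : ι → G, g (Finset.univ.filter (fun i => u i ≠ 0)).card ≤
      ∑ d ∈ Finset.range (Fintype.card ι + 1),
        (Fintype.card ι).choose d * ((Fintype.card G : ℝ) ^ d * g d) := by
  have hcard (D : Finset ι) : (Finset.univ.filter
      (fun u : ι → G => Finset.univ.filter (fun i => u i ≠ 0) = D)).card ≤
      Fintype.card G ^ D.card := by
    have : Fintype.card G ^ D.card = (Finset.univ : Finset (D → G)).card := by
      simp
    rw [this]
    refine Finset.card_le_card_of_injOn (fun u i => u i) (fun _ _ => by simp) ?_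
    intro u hu v hv huv
    simp only [Finset.coe_filter, Finset.mem_univ, true_and, Set.mem_ofPred_eq] at hu hv
    ext i
    by_cases hi : i ∈ D
    · exact congrFun huv ⟨i, hi⟩
    · have h1 : u i = 0 := by
        by_contra h
        exact hi (hu ▸ by simpa using h)
      have h2 : v i = 0 := by
        by_contra h
        exact hi (hv ▸ by simpa using h)
      rw [h1, h2]
  rw [← Finset.sum_fiberwise (s := Finset.univ)
    (g := fun u : ι → G => Finset.univ.filter (fun i => u i ≠ 0))]
  calc _ ≤ ∑ D : Finset ι, (Fintype.card G : ℝ) ^ D.card * g D.card := by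
        refine Finset.sum_le_sum fun D _ => ?_
        rw [Finset.sum_congr rfl (g := fun _ => g D.card), Finset.sum_const, nsmul_eq_mul]
        · exact mul_le_mul_of_nonneg_right (by exact_mod_cast hcard D) (hg _)
        · intro u hu
          rw [(Finset.mem_filter.1 hu).2]
    _ = _ := by
        rw [← Finset.powerset_univ, Finset.sum_powerset_apply_card
          (fun d => (Fintype.card G : ℝ) ^ d * g d)]
        simp [nsmul_eq_mul, Finset.card_univ]

theorem exists_diffCount_ge {κ G : Type*} [Fintype κ] [DecidableEq G] [Fintype G] [Nonempty G]
    (v : κ → G) : ∃ a : G,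
      Fintype.card κ * (Finset.univ.filter (fun k => v k ≠ a)).card ≤ diffCount v ∧
      2 * ((Finset.univ.filter (fun k => v k ≠ a)).card *
        (Fintype.card κ - (Finset.univ.filter (fun k => v k ≠ a)).card)) ≤ diffCount v := by
  obtain ⟨a, -, ha⟩ := Finset.exists_min_image Finset.univ
    (fun a => (Finset.univ.filter (fun k => v k ≠ a)).card) Finset.univ_nonempty
  refine ⟨a, ?_, ?_⟩
  · have h : ∀ k, (Finset.univ.filter (fun l => v l ≠ a)).card ≤
        ∑ l, if v k ≠ v l then 1 else 0 := by
      intro k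
      rw [← Finset.card_filter]
      simpa only [ne_comm] using ha (v k) (Finset.mem_univ _)
    calc _ = ∑ _k : κ, (Finset.univ.filter (fun l => v l ≠ a)).card := by simp [Finset.card_univ]
      _ ≤ _ := Finset.sum_le_sum fun k _ => h k
  · have hcompl : (Finset.univ.filter (fun k => v k = a)).card =
        Fintype.card κ - (Finset.univ.filter (fun k => v k ≠ a)).card := by
      have := Finset.card_filter_add_card_filter_not (s := (Finset.univ : Finset κ))
        (fun k => v k = a)
      rw [Finset.card_univ] at this
      simp only [ne_eq]
      omega
    rw [← hcompl]
    have hprod : (Finset.univ.filter (fun k => v k ≠ a)).card *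
        (Finset.univ.filter (fun k => v k = a)).card =
        ∑ k, ∑ l, if v k ≠ a ∧ v l = a then 1 else 0 := by
      rw [Finset.card_filter, Finset.card_filter, Finset.sum_mul_sum]
      refine Finset.sum_congr rfl fun k _ => Finset.sum_congr rfl fun l _ => ?_
      by_cases h1 : v k = a <;> by_cases h2 : v l = a <;> simp [h1, h2]
    rw [two_mul]
    nth_rewrite 2 [hprod]
    rw [Finset.sum_comm, hprod, ← Finset.sum_add_distrib, diffCount]
    refine Finset.sum_le_sum fun k _ => ?_
    rw [← Finset.sum_add_distrib]
    refine Finset.sum_le_sum fun l _ => ?_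
    by_cases h1 : v k = a <;> by_cases h2 : v l = a <;> simp [h1, h2, Ne.symm]

theorem cornerCount_eq_sum_diffCount {ι κ G : Type*} [AddCommGroup G] [DecidableEq G]
    [Fintype ι] [Fintype κ] (F : ι → κ → G) :
    cornerCount F = ∑ i, ∑ j, diffCount (F j - F i) := by
  refine Finset.sum_congr rfl fun i _ => Finset.sum_congr rfl fun j _ =>
    Finset.sum_congr rfl fun k _ => Finset.sum_congr rfl fun l _ => ?_
  refine if_congr (not_congr ?_) rfl rfl
  simp only [cornerSum, Pi.sub_apply]
  constructor <;> intro h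
  · rw [← sub_eq_zero, ← neg_eq_zero, ← h]; abel
  · rw [← sub_eq_zero, ← neg_eq_zero] at h; rw [← h]; abel

theorem four_mul_le_cornerCount {ι G : Type*} [AddCommGroup G] [DecidableEq G]
    [Fintype ι] [DecidableEq ι] (F : ι → ι → G) {R : ℕ}
    (hR : R = (Finset.univ.filter (fun p : ι × ι => F p.1 p.2 ≠ 0)).card) :
    4 * (R * Fintype.card ι ^ 2) ≤ cornerCount F + 4 * (R * (3 * Fintype.card ι * R)) := by
  have hR' : R = ∑ i, ∑ k, if F i k ≠ 0 then 1 else 0 := by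
    rw [hR, Finset.card_filter, Fintype.sum_prod_type]
  set E := ∑ i, ∑ j, ∑ k, ∑ l,
    if F i k ≠ 0 ∧ F i l = 0 ∧ F j k = 0 ∧ F j l = 0 then 1 else 0 with hE
  have hQ : 4 * E ≤ cornerCount F := by
    have e2 : E = ∑ i, ∑ j, ∑ k, ∑ l,
        if F j k ≠ 0 ∧ F j l = 0 ∧ F i k = 0 ∧ F i l = 0 then 1 else 0 := by
      rw [hE, Finset.sum_comm]
    have e3 : E = ∑ i, ∑ j, ∑ k, ∑ l,
        if F i l ≠ 0 ∧ F i k = 0 ∧ F j l = 0 ∧ F j k = 0 then 1 else 0 := by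
      rw [hE]
      exact Finset.sum_congr rfl fun i _ => Finset.sum_congr rfl fun j _ => Finset.sum_comm
    have e4 : E = ∑ i, ∑ j, ∑ k, ∑ l,
        if F j l ≠ 0 ∧ F j k = 0 ∧ F i l = 0 ∧ F i k = 0 then 1 else 0 := by
      rw [e3, Finset.sum_comm]
    have : 4 * E = E + E + E + E := by ring
    rw [this]
    nth_rewrite 2 [e2]
    nth_rewrite 2 [e3]
    nth_rewrite 2 [e4]
    rw [hE]
    simp only [← Finset.sum_add_distrib]
    refine Finset.sum_le_sum fun i _ => Finset.sum_le_sum fun j _ =>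
      Finset.sum_le_sum fun k _ => Finset.sum_le_sum fun l _ => ?_
    by_cases h1 : F i k = 0 <;> by_cases h2 : F i l = 0 <;>
      by_cases h3 : F j k = 0 <;> by_cases h4 : F j l = 0 <;>
      simp [cornerSum, h1, h2, h3, h4]
  have hrow (i : ι) : (∑ l, if F i l ≠ 0 then 1 else 0) ≤ R := by
    rw [hR']
    exact Finset.single_le_sum (f := fun i => ∑ l, if F i l ≠ 0 then 1 else 0)
      (fun _ _ => Nat.zero_le _) (Finset.mem_univ i)
  have hcol (k : ι) : (∑ j, if F j k ≠ 0 then 1 else 0) ≤ R := by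
    rw [hR', Finset.sum_comm]
    exact Finset.single_le_sum (f := fun k => ∑ j, if F j k ≠ 0 then 1 else 0)
      (fun _ _ => Nat.zero_le _) (Finset.mem_univ k)
  have hpt (i k : ι) (hik : F i k ≠ 0) : Fintype.card ι ^ 2 ≤
      (∑ j, ∑ l, if F i k ≠ 0 ∧ F i l = 0 ∧ F j k = 0 ∧ F j l = 0 then 1 else 0) +
        3 * Fintype.card ι * R := by
    have hn : 1 ≤ Fintype.card ι := Fintype.card_pos_iff.2 ⟨i⟩
    have h1 : (∑ _j : ι, ∑ l, if F i l ≠ 0 then 1 else 0) ≤ Fintype.card ι * R := by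
      rw [Finset.sum_const, smul_eq_mul, Finset.card_univ]
      exact Nat.mul_le_mul_left _ (hrow i)
    have h2 : (∑ j : ι, ∑ _l : ι, if F j k ≠ 0 then 1 else 0) ≤ Fintype.card ι * R := by
      rw [Finset.sum_comm, Finset.sum_const, smul_eq_mul, Finset.card_univ]
      exact Nat.mul_le_mul_left _ (hcol k)
    have h3 : (∑ j : ι, ∑ l : ι, if F j l ≠ 0 then 1 else 0) ≤ Fintype.card ι * R := by
      rw [← hR']
      exact Nat.le_mul_of_pos_left _ hn
    have h0 : Fintype.card ι ^ 2 = ∑ _j : ι, ∑ _l : ι, 1 := by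
      simp [Finset.card_univ, sq]
    calc Fintype.card ι ^ 2 ≤
        (∑ j, ∑ l, if F i k ≠ 0 ∧ F i l = 0 ∧ F j k = 0 ∧ F j l = 0 then 1 else 0) +
        ((∑ _j : ι, ∑ l, if F i l ≠ 0 then 1 else 0) +
        (∑ j : ι, ∑ _l : ι, if F j k ≠ 0 then 1 else 0) +
        (∑ j : ι, ∑ l : ι, if F j l ≠ 0 then 1 else 0)) := by
          rw [h0]
          simp only [← Finset.sum_add_distrib]
          refine Finset.sum_le_sum fun j _ => Finset.sum_le_sum fun l _ => ?_
          by_cases h2 : F i l = 0 <;> by_cases h3 : F j k = 0 <;> by_cases h4 : F j l = 0 <;>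
            simp [hik, h2, h3, h4]
      _ ≤ _ := by nlinarith
  have hsum : R * Fintype.card ι ^ 2 ≤ E + R * (3 * Fintype.card ι * R) := by
    have hE' : E = ∑ i, ∑ k, ∑ j, ∑ l,
        if F i k ≠ 0 ∧ F i l = 0 ∧ F j k = 0 ∧ F j l = 0 then 1 else 0 :=
      Finset.sum_congr rfl fun i _ => Finset.sum_comm
    have l1 : R * Fintype.card ι ^ 2 =
        ∑ i, ∑ k, (if F i k ≠ 0 then 1 else 0) * Fintype.card ι ^ 2 := by
      simp only [← Finset.sum_mul]
      rw [← hR']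
    have l2 : R * (3 * Fintype.card ι * R) =
        ∑ i, ∑ k, (if F i k ≠ 0 then 1 else 0) * (3 * Fintype.card ι * R) := by
      simp only [← Finset.sum_mul]
      rw [← hR']
    rw [l1, l2, hE']
    simp only [← Finset.sum_add_distrib]
    refine Finset.sum_le_sum fun i _ => Finset.sum_le_sum fun k _ => ?_
    by_cases hik : F i k = 0
    · simp [hik]
    · have := hpt i k hik
      simp only [ne_eq, hik, not_false_eq_true, true_and, if_true, one_mul] at this ⊢
      exact this
  omega

/-- Translating by a row turns the corner count into a lower bound by a sum over rows. -/
theorem exists_row_sum_diffCount_le {ι κ G : Type*} [AddCommGroup G] [DecidableEq G]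
    [Fintype ι] [Nonempty ι] [Fintype κ] (F : ι → κ → G) :
    ∃ H : ι → κ → G, cornerSum H = cornerSum F ∧
      Fintype.card ι * ∑ j, diffCount (H j) ≤ cornerCount F := by
  obtain ⟨a, -, ha⟩ := Finset.exists_min_image Finset.univ
    (fun a => ∑ j, diffCount (F j - F a)) Finset.univ_nonempty
  refine ⟨fun j => F j - F a, ?_, ?_⟩
  · ext i j k l
    simp only [cornerSum, Pi.sub_apply]
    abel
  · rw [cornerCount_eq_sum_diffCount, ← smul_eq_mul, ← Finset.card_univ, ← Finset.sum_const]
    exact Finset.sum_le_sum fun i _ => ha i (Finset.mem_univ i)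

/-- Translating by a row and a column turns the corner count into a bound on the support. -/
theorem exists_card_support_le {ι G : Type*} [AddCommGroup G] [DecidableEq G]
    [Fintype ι] [Nonempty ι] (F : ι → ι → G) :
    ∃ H : ι → ι → G, cornerSum H = cornerSum F ∧
      Fintype.card ι ^ 2 * (Finset.univ.filter (fun p : ι × ι => H p.1 p.2 ≠ 0)).card ≤
        cornerCount F := by
  obtain ⟨p, -, hp⟩ := Finset.exists_min_image (Finset.univ : Finset (ι × ι))
    (fun p => ∑ j, ∑ l, if cornerSum F p.1 j p.2 l ≠ 0 then 1 else 0) Finset.univ_nonempty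
  refine ⟨fun j l => cornerSum F p.1 j p.2 l, ?_, ?_⟩
  · ext i j k l
    simp only [cornerSum]
    abel
  · have h : cornerCount F = ∑ p : ι × ι,
        ∑ j, ∑ l, if cornerSum F p.1 j p.2 l ≠ 0 then 1 else 0 := by
      rw [Fintype.sum_prod_type]
      exact Finset.sum_congr rfl fun i _ => Finset.sum_comm
    rw [h, Finset.card_filter, Fintype.sum_prod_type, sq, ← Fintype.card_prod, ← smul_eq_mul,
      ← Finset.card_univ, ← Finset.sum_const]
    exact Finset.sum_le_sum fun i _ => hp i (Finset.mem_univ i)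

theorem sum_le_sum_univ_of_injOn {α β : Type*} [Fintype β] [DecidableEq β] (s : Finset α)
    (f : α → ℝ) (g : β → ℝ) (Φ : α → β) (hΦ : Set.InjOn Φ s) (hg : ∀ b, 0 ≤ g b)
    (hfg : ∀ a ∈ s, f a ≤ g (Φ a)) : ∑ a ∈ s, f a ≤ ∑ b, g b := by
  calc _ ≤ ∑ a ∈ s, g (Φ a) := Finset.sum_le_sum hfg
    _ = ∑ b ∈ s.image Φ, g b := (Finset.sum_image hΦ).symm
    _ ≤ _ := Finset.sum_le_sum_of_subset_of_nonneg (Finset.subset_univ _) fun b _ _ => hg b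

theorem natCast_pow_eq_exp {x : ℕ} (hx : 0 < x) (d : ℕ) :
    (x : ℝ) ^ d = Real.exp (d * Real.log x) := by
  rw [Real.exp_nat_mul, Real.exp_log (by exact_mod_cast hx)]

theorem half_pow_eq_exp (d : ℕ) : (1 / 2 : ℝ) ^ d = Real.exp (-(d * Real.log 2)) := by
  rw [Real.exp_neg, Real.exp_nat_mul, Real.exp_log two_pos]
  simp

theorem choose_mul_exp_le {n q d : ℕ} (hn : 1 ≤ n) (hq : 2 ≤ q) (hd : d ≤ n) {A r : ℝ}
    (hr : 1 ≤ r) (hl : Real.log n = r ^ 2) (hA : 640 * r * Real.log q ≤ A) :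
    (n.choose d : ℝ) * ((q : ℝ) ^ d * Real.exp (-(A * d + r ^ 2 * (d * (n - d) / n)))) ≤
      (1 / 2) ^ d := by
  have hn0 : (0 : ℝ) < n := by exact_mod_cast hn
  have hL2 : 0.69 < Real.log 2 := by linarith [Real.log_two_gt_d9]
  have hL1 : Real.log 2 < 0.7 := by linarith [Real.log_two_lt_d9]
  have hL : Real.log 2 ≤ Real.log q := Real.log_le_log two_pos (by exact_mod_cast hq)
  have hd0 : (0 : ℝ) ≤ d := Nat.cast_nonneg d
  have hdn : (d : ℝ) ≤ n := by exact_mod_cast hd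
  have hA' : Real.log q + r + Real.log 2 ≤ A := by nlinarith
  rw [natCast_pow_eq_exp (by omega) d, half_pow_eq_exp, ← Real.exp_add]
  rcases le_total (d * r) (n : ℝ) with h | h
  · have hc : (n.choose d : ℝ) ≤ Real.exp (d * Real.log n) := by
      rw [← natCast_pow_eq_exp hn]
      exact_mod_cast Nat.choose_le_pow n d
    refine (mul_le_mul_of_nonneg_right hc (Real.exp_pos _).le).trans ?_
    rw [← Real.exp_add, Real.exp_le_exp, hl]
    have h1 : (d : ℝ) * (n - d) / n = d - d * d / n := by field_simp
    have h2 : r ^ 2 * (d * d / n : ℝ) ≤ r * d := by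
      rw [← mul_div_assoc, div_le_iff₀ hn0]
      nlinarith [mul_le_mul_of_nonneg_left h (mul_nonneg (by linarith : 0 ≤ r) hd0)]
    rw [h1]
    nlinarith [mul_le_mul_of_nonneg_left hA' hd0]
  · have hc : (n.choose d : ℝ) ≤ Real.exp (n * Real.log 2) := by
      have := natCast_pow_eq_exp two_pos n
      push_cast at this
      rw [← this]
      exact_mod_cast Nat.choose_le_two_pow n d
    refine (mul_le_mul_of_nonneg_right hc (Real.exp_pos _).le).trans ?_
    rw [← Real.exp_add, Real.exp_le_exp]
    have h1 : 0 ≤ r ^ 2 * (d * (n - d) / n : ℝ) :=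
      mul_nonneg (sq_nonneg _) (div_nonneg (mul_nonneg hd0 (by linarith)) hn0.le)
    have h2 : (n : ℝ) * Real.log 2 ≤ d * r := by nlinarith
    nlinarith [mul_le_mul_of_nonneg_left hA' hd0]

theorem sum_exp_diffCount_le {n q : ℕ} [NeZero q] (hn : 1 ≤ n) (hq : 2 ≤ q) {A r : ℝ}
    (hr : 1 ≤ r) (hl : Real.log n = r ^ 2) (hA : 640 * r * Real.log q ≤ A) :
    ∑ v : Fin n → ZMod q, Real.exp (-((r ^ 2 + 2 * A) / (2 * n) * diffCount v)) ≤ 2 * q := by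
  have hn0 : (0 : ℝ) < n := by exact_mod_cast hn
  have hL0 : 0 ≤ Real.log q := Real.log_natCast_nonneg q
  have hA0 : 0 ≤ A := le_trans (by positivity) hA
  choose a ha₁ ha₂ using fun v : Fin n → ZMod q => exists_diffCount_ge v
  set g : ℕ → ℝ := fun d => Real.exp (-(A * d + r ^ 2 * (d * (n - d) / n))) with hg
  calc _ ≤ ∑ p : ZMod q × (Fin n → ZMod q),
        g (Finset.univ.filter (fun i => p.2 i ≠ 0)).card := by
        refine sum_le_sum_univ_of_injOn _ _ _ (fun v => (a v, fun i => v i - a v)) ?_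
          (fun _ => (Real.exp_pos _).le) ?_
        · intro v _ w _ h
          simp only [Prod.mk.injEq] at h
          ext i
          have := congrFun h.2 i
          rw [h.1] at this
          exact sub_left_injective this
        · intro v _
          simp only [hg, sub_ne_zero]
          rw [Real.exp_le_exp, neg_le_neg_iff]
          have h1 := ha₁ v
          have h2 := ha₂ v
          have hd : (Finset.univ.filter (fun k => v k ≠ a v)).card ≤ n := by
            simpa using Finset.card_le_univ (Finset.univ.filter (fun k => v k ≠ a v))
          rw [Fintype.card_fin] at h1 h2
          generalize (Finset.univ.filter (fun k => v k ≠ a v)).card = d at h1 h2 hd ⊢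
          have h1' : (n : ℝ) * d ≤ diffCount v := by exact_mod_cast h1
          have h2' : 2 * ((d : ℝ) * (n - d)) ≤ diffCount v := by
            rw [← Nat.cast_sub hd]
            exact_mod_cast h2
          have e : (r ^ 2 + 2 * A) / (2 * n) * (diffCount v : ℝ) =
              A * (diffCount v / n) + r ^ 2 * (diffCount v / 2 / n) := by
            field_simp
            ring
          rw [e]
          gcongr
          · rw [le_div_iff₀ hn0]; linarith
          · linarith
    _ = q * ∑ u : Fin n → ZMod q, g (Finset.univ.filter (fun i => u i ≠ 0)).card := by
        rw [Fintype.sum_prod_type]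
        simp [Finset.card_univ, ZMod.card]
    _ ≤ q * ∑ d ∈ Finset.range (n + 1), (n.choose d : ℝ) * ((q : ℝ) ^ d * g d) := by
        gcongr
        have := sum_card_support_le (ι := Fin n) (G := ZMod q) g (fun _ => (Real.exp_pos _).le)
        simpa only [Fintype.card_fin, ZMod.card] using this
    _ ≤ q * ∑ d ∈ Finset.range (n + 1), (1 / 2 : ℝ) ^ d := by
        gcongr with d hd
        exact choose_mul_exp_le hn hq (by simpa [Nat.lt_succ_iff] using hd) hr hl hA
    _ ≤ q * 2 := by
        gcongr
        exact sum_geometric_two_le _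
    _ = 2 * q := mul_comm _ _

theorem sum_exp_card_support_le {n q : ℕ} [NeZero q] (hn : 1 ≤ n) (hq : 2 ≤ q) {A r c : ℝ}
    (hr : 1 ≤ r) (hl : Real.log n = r ^ 2) (hc : 0 ≤ c)
    (hA : 2 * c * Real.log q + 200 * r * Real.log q ≤ 2 * A) :
    ∑ u : Fin n × Fin n → ZMod q,
      (if (Finset.univ.filter (fun p => u p ≠ 0)).card = 0 then 0 else
        Real.exp (-((2 * r ^ 2 + 2 * A - 6 * r) *
          (Finset.univ.filter (fun p => u p ≠ 0)).card))) ≤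
      Real.exp (-(2 * c * Real.log q)) / 4 := by
  have hL2 : 0.69 < Real.log 2 := by linarith [Real.log_two_gt_d9]
  have hL1 : Real.log 2 < 0.7 := by linarith [Real.log_two_lt_d9]
  have hL : Real.log 2 ≤ Real.log q := Real.log_le_log two_pos (by exact_mod_cast hq)
  have hcL : 0 ≤ c * Real.log q := mul_nonneg hc (by linarith)
  set g : ℕ → ℝ := fun d => if d = 0 then 0 else
    Real.exp (-((2 * r ^ 2 + 2 * A - 6 * r) * d)) with hg
  have hg0 (d : ℕ) : 0 ≤ g d := by
    simp only [hg]
    split_ifs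
    exacts [le_rfl, (Real.exp_pos _).le]
  have hterm (d : ℕ) : ((n * n).choose d : ℝ) * ((q : ℝ) ^ d * g d) ≤
      Real.exp (-(2 * c * Real.log q)) / 8 * (1 / 2) ^ d := by
    rcases Nat.eq_zero_or_pos d with rfl | hd
    · simp only [hg, if_true, mul_zero]
      positivity
    have hd1 : (1 : ℝ) ≤ d := by exact_mod_cast hd
    have hch : ((n * n).choose d : ℝ) ≤ Real.exp (d * (2 * r ^ 2)) := by
      rw [two_mul, ← hl, ← Real.log_mul (by positivity) (by positivity), ← Nat.cast_mul,
        ← natCast_pow_eq_exp (Nat.mul_pos hn hn)]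
      exact_mod_cast Nat.choose_le_pow (n * n) d
    have h8 : (8 : ℝ) = Real.exp (3 * Real.log 2) := by
      rw [← Real.log_rpow two_pos, Real.exp_log (by positivity)]
      norm_num
    have hX : 2 * (c * Real.log q) + 4 * Real.log 2 ≤ 2 * A - Real.log q - 6 * r := by nlinarith
    simp only [hg, hd.ne', if_false]
    refine (mul_le_mul_of_nonneg_right hch (by positivity)).trans ?_
    rw [natCast_pow_eq_exp (by omega) d, half_pow_eq_exp, h8, ← Real.exp_sub, ← Real.exp_add,
      ← Real.exp_add, ← Real.exp_add, Real.exp_le_exp]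
    nlinarith [mul_le_mul_of_nonneg_left hX (by linarith : (0 : ℝ) ≤ d),
      mul_le_mul_of_nonneg_right hd1 hcL, mul_le_mul_of_nonneg_right hd1 (by linarith :
        0 ≤ Real.log 2)]
  calc _ ≤ ∑ d ∈ Finset.range (n * n + 1), ((n * n).choose d : ℝ) * ((q : ℝ) ^ d * g d) := by
        have := sum_card_support_le (ι := Fin n × Fin n) (G := ZMod q) g hg0
        simpa only [Fintype.card_prod, Fintype.card_fin, ZMod.card] using this
    _ ≤ ∑ d ∈ Finset.range (n * n + 1),
        Real.exp (-(2 * c * Real.log q)) / 8 * (1 / 2) ^ d :=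
        Finset.sum_le_sum fun d _ => hterm d
    _ ≤ Real.exp (-(2 * c * Real.log q)) / 8 * 2 := by
        rw [← Finset.mul_sum]
        gcongr
        exact sum_geometric_two_le _
    _ = _ := by ring

theorem sum_exp_Nboxes_of_large {m n q : ℕ} [NeZero q] (hmn : m + 1 = n) (hn : 3 ≤ n)
    (hq : 2 ≤ q) {A r c b : ℝ} (hr : 1 ≤ r) (hl : Real.log n = r ^ 2)
    (hA : A = b * r * Real.log q) (hb : 640 ≤ b) (hbc : 6 / 5 * c ≤ b) :
    ∑ y ∈ Finset.univ.filter (fun y : Matrix (Fin m) (Fin m) (ZMod q) =>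
        (n : ℝ) ^ 3 / (4 * r) ≤ Nboxes y),
      Real.exp (-((2 * r ^ 2 + 8 * A) * Nboxes y / n ^ 2)) ≤
      Real.exp (-(2 * c * Real.log q)) / 4 := by
  have hn3 : (3 : ℝ) ≤ n := by exact_mod_cast hn
  have hL : Real.log 2 ≤ Real.log q := Real.log_le_log two_pos (by exact_mod_cast hq)
  have hL0 : 0 < Real.log q := lt_of_lt_of_le (Real.log_pos one_lt_two) hL
  have hA0 : 640 * r * Real.log q ≤ A := by rw [hA]; gcongr
  have hApos : 0 ≤ A := le_trans (by positivity) hA0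
  have : Nonempty (Fin n) := ⟨⟨0, by omega⟩⟩
  choose H hH₁ hH₂ using fun y : Matrix (Fin m) (Fin m) (ZMod q) =>
    exists_row_sum_diffCount_le (partialSum n y)
  calc _ ≤ ∑ v : Fin n → Fin n → ZMod q, Real.exp (-(A * n / r)) *
        ∏ j, Real.exp (-((r ^ 2 + 2 * A) / (2 * n) * diffCount (v j))) := by
        refine sum_le_sum_univ_of_injOn _ _ _ H ?_ (fun _ => by positivity) ?_
        · intro y _ z _ h
          refine cornerSum_partialSum_injective hmn ?_
          simp only
          rw [← hH₁ y, ← hH₁ z, h]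
        · intro y hy
          have hN := (Finset.mem_filter.1 hy).2
          have h4 := (hH₂ y).trans (cornerCount_le_four_mul_Nboxes hmn y)
          rw [Fintype.card_fin] at h4
          have h4' : (n : ℝ) * ∑ j, (diffCount (H y j) : ℝ) ≤ 4 * Nboxes y := by
            exact_mod_cast h4
          rw [← Real.exp_sum, ← Real.exp_add, Real.exp_le_exp, Finset.sum_neg_distrib,
            ← Finset.mul_sum, ← neg_add, neg_le_neg_iff]
          have e : (2 * r ^ 2 + 8 * A) * (Nboxes y : ℝ) / n ^ 2 =
              4 * A / n ^ 2 * Nboxes y + (r ^ 2 + 2 * A) / (2 * n) * (4 * Nboxes y / n) := by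
            field_simp
            ring
          rw [e]
          gcongr
          · calc A * n / r = 4 * A / n ^ 2 * ((n : ℝ) ^ 3 / (4 * r)) := by field_simp
              _ ≤ _ := by gcongr
          · rw [le_div_iff₀ (by positivity)]
            linarith
    _ = Real.exp (-(A * n / r)) * (∑ v : Fin n → ZMod q,
        Real.exp (-((r ^ 2 + 2 * A) / (2 * n) * diffCount v))) ^ n := by
        rw [← Finset.mul_sum, Fintype.sum_pow]
    _ ≤ Real.exp (-(A * n / r)) * (2 * q) ^ n := by
        gcongr
        exact sum_exp_diffCount_le (by omega) hq hr hl hA0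
    _ ≤ _ := by
        have hq0 : (q : ℝ) ≠ 0 := by positivity
        have h2q : (2 * q : ℝ) ^ n = Real.exp (n * (Real.log 2 + Real.log q)) := by
          rw [Real.exp_nat_mul, Real.exp_add, Real.exp_log two_pos,
            Real.exp_log (by positivity)]
        have h4 : (4 : ℝ) = Real.exp (2 * Real.log 2) := by
          rw [← Real.log_rpow two_pos, Real.exp_log (by positivity)]
          norm_num
        have hAn : A * n / r = b * n * Real.log q := by
          rw [hA]
          field_simp
        rw [h2q, h4, ← Real.exp_add, ← Real.exp_sub, Real.exp_le_exp, hAn]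
        have hbn : 2 * c + 2 * n + 2 ≤ b * n := by nlinarith
        nlinarith [mul_le_mul_of_nonneg_right hbn hL0.le]

theorem sum_exp_Nboxes_of_small {m n q : ℕ} [NeZero q] (hmn : m + 1 = n) (hn : 3 ≤ n)
    (hq : 2 ≤ q) {A r c b : ℝ} (hr : 1 ≤ r) (hl : Real.log n = r ^ 2) (hc : 0 ≤ c)
    (hA : A = b * r * Real.log q) (hb : 640 ≤ b) (hbc : 6 / 5 * c ≤ b) :
    ∑ y ∈ Finset.univ.filter (fun y : Matrix (Fin m) (Fin m) (ZMod q) =>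
        y ≠ 0 ∧ (Nboxes y : ℝ) < (n : ℝ) ^ 3 / (4 * r)),
      Real.exp (-((2 * r ^ 2 + 8 * A) * Nboxes y / n ^ 2)) ≤
      Real.exp (-(2 * c * Real.log q)) / 4 := by
  have hn3 : (3 : ℝ) ≤ n := by exact_mod_cast hn
  have hL : Real.log 2 ≤ Real.log q := Real.log_le_log two_pos (by exact_mod_cast hq)
  have hL0 : 0 < Real.log q := lt_of_lt_of_le (Real.log_pos one_lt_two) hL
  have hApos : 0 ≤ A := by rw [hA]; positivity
  have hA2 : 2 * c * Real.log q + 200 * r * Real.log q ≤ 2 * A := by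
    rw [hA]
    have : c + 100 * r ≤ b * r := by nlinarith
    nlinarith [mul_le_mul_of_nonneg_right this hL0.le]
  have : Nonempty (Fin n) := ⟨⟨0, by omega⟩⟩
  choose H hH₁ hH₂ using fun y : Matrix (Fin m) (Fin m) (ZMod q) =>
    exists_card_support_le (partialSum n y)
  refine le_trans ?_ (sum_exp_card_support_le (by omega) hq hr hl hc hA2)
  refine sum_le_sum_univ_of_injOn _ _ _ (fun y p => H y p.1 p.2) ?_ ?_ ?_
  · intro y _ z _ h
    have hyz : H y = H z := by
      ext i k
      exact congrFun h (i, k)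
    refine cornerSum_partialSum_injective hmn ?_
    simp only
    rw [← hH₁ y, ← hH₁ z, hyz]
  · intro u
    split_ifs
    exacts [le_rfl, (Real.exp_pos _).le]
  · intro y hy
    obtain ⟨-, hy0, hN⟩ := Finset.mem_filter.1 hy
    have hR : (Finset.univ.filter (fun p : Fin n × Fin n => H y p.1 p.2 ≠ 0)).card ≠ 0 := by
      intro h0
      refine hy0 (cornerSum_partialSum_injective hmn ?_)
      have hz : H y = 0 := by
        ext i k
        by_contra hne
        rw [Finset.card_eq_zero] at h0
        exact Finset.notMem_empty (i, k) (h0 ▸ Finset.mem_filter.2 ⟨Finset.mem_univ _, hne⟩)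
      simp only
      rw [← hH₁ y, hz, partialSum_zero]
    rw [if_neg hR, Real.exp_le_exp, neg_le_neg_iff]
    have hQ := cornerCount_le_four_mul_Nboxes hmn y
    have h1 := (hH₂ y).trans hQ
    have h2 := four_mul_le_cornerCount (H y) rfl
    have hcc : cornerCount (H y) = cornerCount (partialSum n y) := by
      simp only [cornerCount, hH₁ y]
    rw [hcc] at h2
    replace h2 := h2.trans (Nat.add_le_add_right hQ _)
    rw [Fintype.card_fin] at h1 h2
    generalize (Finset.univ.filter (fun p : Fin n × Fin n => H y p.1 p.2 ≠ 0)).card = R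
      at h1 h2 ⊢
    have h1' : (n : ℝ) ^ 2 * R ≤ 4 * Nboxes y := by exact_mod_cast h1
    have h2' : 4 * ((R : ℝ) * n ^ 2) ≤ 4 * Nboxes y + 4 * (R * (3 * n * R)) := by
      exact_mod_cast h2
    have hn0 : (0 : ℝ) < n := by linarith
    set x : ℝ := Nboxes y / (n : ℝ) ^ 2 with hx
    have hNx : (Nboxes y : ℝ) = x * n ^ 2 := by rw [hx]; field_simp
    have e1 : (R : ℝ) ≤ 4 * x := by
      rw [hx, ← mul_div_assoc, le_div_iff₀ (by positivity)]
      linarith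
    have e2 : 4 * x * r ≤ n := by
      rw [lt_div_iff₀ (by positivity), hNx] at hN
      have : (4 * x * r) * (n : ℝ) ^ 2 ≤ n * (n : ℝ) ^ 2 := by nlinarith
      exact le_of_mul_le_mul_right this (by positivity)
    have e3 : (R : ℝ) * n ≤ x * n + 3 * R * R := by
      rw [hNx] at h2'
      have : ((R : ℝ) * n) * n ≤ (x * n + 3 * R * R) * n := by nlinarith
      exact le_of_mul_le_mul_right this hn0
    have hR0 : (0 : ℝ) ≤ R := Nat.cast_nonneg R
    have e4 : (R : ℝ) * r ≤ n := by nlinarith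
    have e5 : r * (R : ℝ) ≤ r * x + 3 * R := by
      have : (r * (R : ℝ)) * n ≤ (r * x + 3 * R) * n := by nlinarith
      exact le_of_mul_le_mul_right this hn0
    rw [mul_div_assoc, ← hx]
    nlinarith

theorem sum_exp_Nboxes_le {m n q : ℕ} [NeZero q] (hmn : m + 1 = n) (hn : 3 ≤ n)
    (hq : 2 ≤ q) {A r c b : ℝ} (hr : 1 ≤ r) (hl : Real.log n = r ^ 2) (hc : 0 ≤ c)
    (hA : A = b * r * Real.log q) (hb : 640 ≤ b) (hbc : 6 / 5 * c ≤ b) :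
    ∑ y ∈ Finset.univ.filter (fun y : Matrix (Fin m) (Fin m) (ZMod q) => y ≠ 0),
      Real.exp (-((2 * r ^ 2 + 8 * A) * Nboxes y / n ^ 2)) ≤
      Real.exp (-(2 * c * Real.log q)) / 2 := by
  have h1 := sum_exp_Nboxes_of_large hmn hn hq hr hl hA hb hbc
  have h2 := sum_exp_Nboxes_of_small hmn hn hq hr hl hc hA hb hbc
  rw [← Finset.sum_filter_add_sum_filter_not _ (fun y : Matrix (Fin m) (Fin m) (ZMod q) =>
    (Nboxes y : ℝ) < (n : ℝ) ^ 3 / (4 * r)), Finset.filter_filter, Finset.filter_filter]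
  have h3 : ∑ y ∈ Finset.univ.filter (fun y : Matrix (Fin m) (Fin m) (ZMod q) =>
        y ≠ 0 ∧ ¬ (Nboxes y : ℝ) < (n : ℝ) ^ 3 / (4 * r)),
      Real.exp (-((2 * r ^ 2 + 8 * A) * Nboxes y / n ^ 2)) ≤
      ∑ y ∈ Finset.univ.filter (fun y : Matrix (Fin m) (Fin m) (ZMod q) =>
        (n : ℝ) ^ 3 / (4 * r) ≤ Nboxes y),
      Real.exp (-((2 * r ^ 2 + 8 * A) * Nboxes y / n ^ 2)) := by
    refine Finset.sum_le_sum_of_subset_of_nonneg ?_ fun _ _ _ => (Real.exp_pos _).le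
    exact Finset.monotone_filter_right _ fun y _ h => not_lt.1 h.2
  linarith

theorem one_le_sqrt_log {n : ℕ} (hn : 3 ≤ n) : 1 ≤ Real.sqrt (Real.log n) := by
  rw [Real.one_le_sqrt, Real.le_log_iff_exp_le (by positivity)]
  have : (3 : ℝ) ≤ n := by exact_mod_cast hn
  linarith [Real.exp_one_lt_d9]

theorem six_fifths_le_log_log {n : ℕ} (hn : 3 ≤ n) :
    6 / 5 ≤ Real.log (Real.log (16 * n)) := by
  have hn3 : (3 : ℝ) ≤ n := by exact_mod_cast hn
  have h1 : (3.4 : ℝ) ≤ Real.log (16 * n) := by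
    have : Real.log ((2 : ℝ) ^ 5) ≤ Real.log (16 * n) :=
      Real.log_le_log (by positivity) (by linarith)
    rw [Real.log_pow] at this
    push_cast at this
    linarith [Real.log_two_gt_d9]
  have h2 : Real.exp (6 / 5) ≤ 3.4 := by
    refine le_of_pow_le_pow_left₀ (n := 5) (by norm_num) (by norm_num) ?_
    rw [← Real.exp_nat_mul]
    have e : ((5 : ℕ) : ℝ) * (6 / 5) = ((6 : ℕ) : ℝ) * 1 := by norm_num
    rw [e, Real.exp_nat_mul]
    calc Real.exp 1 ^ 6 ≤ 2.7182818286 ^ 6 := by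
          gcongr
          exact Real.exp_one_lt_d9.le
      _ ≤ _ := by norm_num
  rw [Real.le_log_iff_exp_le (by linarith)]
  exact h2.trans h1

theorem rpow_le_exp_of_nonneg {x s : ℝ} (hx : x ≤ 1) (hs : 0 ≤ s) :
    (1 - x) ^ s ≤ Real.exp (-(x * s)) := by
  have h := Real.rpow_le_rpow (by linarith) (Real.one_sub_le_exp_neg x) hs
  rwa [← Real.exp_mul, neg_mul] at h

theorem stmt18 (n q : ℕ) [NeZero q] (hn : 3 ≤ n) (hq : 2 ≤ q)
    (α : ℝ) (hα : α = Real.log (Real.log (16 * n)) * Real.sqrt (Real.log n))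
    (c : ℝ) (hc : 640 / Real.log (Real.log (16 * n)) ≤ c)
    (t : ℝ)
    (ht : t = (n : ℝ) ^ 2 / (4 * (1 - Real.cos (2 * Real.pi / q))) * Real.log n
        + (n : ℝ) ^ 2 / (1 - Real.cos (2 * Real.pi / q)) * c * α * Real.log q) :
    ∑ y ∈ Finset.univ.filter
        (fun y : Matrix (Fin (n - 1)) (Fin (n - 1)) (ZMod q) =>
          y ≠ 0 ∧ (Nboxes y : ℝ) ≤ (n.choose 2 : ℝ) ^ 2 / (1 - Real.cos (2 * Real.pi / q))),
      (1 - (1 - Real.cos (2 * Real.pi / q)) * (Nboxes y : ℝ) / (n.choose 2 : ℝ) ^ 2) ^ (2 * t)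
      ≤ (q : ℝ) ^ (-(2 * c)) / 2 := by
  have hn3 : (3 : ℝ) ≤ n := by exact_mod_cast hn
  have hq2 : (2 : ℝ) ≤ q := by exact_mod_cast hq
  have hLL := six_fifths_le_log_log hn
  have hr := one_le_sqrt_log hn
  have hl : Real.log n = Real.sqrt (Real.log n) ^ 2 :=
    (Real.sq_sqrt (Real.log_natCast_nonneg n)).symm
  have hLL0 : 0 < Real.log (Real.log (16 * n)) := by linarith
  have hc0 : 0 ≤ c := le_trans (by positivity) hc
  have hb : 640 ≤ c * Real.log (Real.log (16 * n)) := (div_le_iff₀ hLL0).1 hc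
  have hL0 : 0 ≤ Real.log q := Real.log_natCast_nonneg q
  have key := sum_exp_Nboxes_le (m := n - 1) (by omega) hn hq hr hl hc0 rfl hb (by nlinarith)
  have hγ : 0 < 1 - Real.cos (2 * Real.pi / q) := by
    have hq0 : (0 : ℝ) < q := by linarith
    have h1 : 0 < 2 * Real.pi / q := by positivity
    have h2 : 2 * Real.pi / q ≤ Real.pi := by
      rw [div_le_iff₀ hq0]
      nlinarith [Real.pi_pos]
    have := Real.cos_lt_cos_of_nonneg_of_le_pi le_rfl h2 h1
    rw [Real.cos_zero] at this
    linarith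
  set γ := 1 - Real.cos (2 * Real.pi / q) with hγdef
  set r := Real.sqrt (Real.log n) with hrdef
  set b := c * Real.log (Real.log (16 * n)) with hbdef
  have hr0 : 0 < r := by linarith
  have hC : (n.choose 2 : ℝ) = n * (n - 1) / 2 := Nat.cast_choose_two ℝ n
  have ht' : 2 * t = n ^ 2 / γ * (r ^ 2 / 2 + 2 * (b * r * Real.log q)) := by
    rw [ht, hα, hl, hbdef]
    field_simp
    ring
  have ht0 : 0 ≤ 2 * t := by
    rw [ht']
    positivity
  have hqc : (q : ℝ) ^ (-(2 * c)) = Real.exp (-(2 * c * Real.log q)) := by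
    rw [Real.rpow_def_of_pos (by linarith)]
    ring_nf
  rw [hqc]
  refine le_trans (le_trans (Finset.sum_le_sum fun y hy => ?_)
    (Finset.sum_le_sum_of_subset_of_nonneg
      (Finset.monotone_filter_right _ fun y _ h => h.1) fun _ _ _ => (Real.exp_pos _).le)) key
  have hN := (Finset.mem_filter.1 hy).2.2
  have hCpos : (0 : ℝ) < (n.choose 2 : ℝ) := by
    rw [hC]
    have : (0 : ℝ) < n - 1 := by linarith
    positivity
  refine (rpow_le_exp_of_nonneg ?_ ht0).trans ?_
  · rw [div_le_one (by positivity), mul_comm]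
    exact (le_div_iff₀ hγ).1 hN
  · rw [Real.exp_le_exp, neg_le_neg_iff, ht', hC]
    have hm : (0 : ℝ) < n - 1 := by linarith
    have e : γ * (Nboxes y : ℝ) / (n * (n - 1) / 2) ^ 2 *
        (n ^ 2 / γ * (r ^ 2 / 2 + 2 * (b * r * Real.log q))) =
        (2 * r ^ 2 + 8 * (b * r * Real.log q)) * Nboxes y / (n - 1) ^ 2 := by
      field_simp
      ring
    rw [e]
    gcongr
    linarith
end

section
/- Let n ≥ 3 and q ≥ 2 be integers. Then every nonzero (n−1)×(n−1) matrix y over ℤ/qℤ satisfies N(y) ≥ (n−1)². -/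
/-- A nonconstant function on `{0, …, m}` takes distinct values on at least `m` pairs. -/
theorem le_card_pairs_ne {α : Type*} [DecidableEq α] (f : ℕ → α) (m b : ℕ) (hb : b ≤ m)
    (hfb : f b ≠ f 0) :
    m ≤ ((Finset.Icc 1 m ×ˢ Finset.Icc 1 m).filter
      (fun p => p.1 ≤ p.2 ∧ f p.2 ≠ f (p.1 - 1))).card := by
  have hb0 : b ≠ 0 := by rintro rfl; exact hfb rfl
  let g : ℕ → ℕ × ℕ := fun c => if f c ≠ f 0 then (1, c) else (min c b + 1, max c b)
  have key : (Finset.Icc 1 m).card ≤ ((Finset.Icc 1 m ×ˢ Finset.Icc 1 m).filter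
      (fun p => p.1 ≤ p.2 ∧ f p.2 ≠ f (p.1 - 1))).card := by
    refine Finset.card_le_card_of_injOn g ?_ ?_
    · intro c hc
      simp only [Finset.coe_Icc, Set.mem_Icc] at hc
      by_cases h : f c = f 0
      · have hcb : c ≠ b := by rintro rfl; exact hfb h
        have hne : f (max c b) ≠ f (min c b) := by
          rcases le_total c b with h' | h'
          · rw [max_eq_right h', min_eq_left h', h]; exact hfb
          · rw [max_eq_left h', min_eq_right h', h]; exact hfb.symm
        simp [g, h, hne]
        omega
      · simp [g, h]
        omega
    · intro c hc d hd hcd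
      simp only [Finset.coe_Icc, Set.mem_Icc] at hc hd
      by_cases h : f c = f 0 <;> by_cases h' : f d = f 0 <;>
        simp [g, h, h'] at hcd <;> omega
  simpa using key

/-- A nonzero vector of length `m` over an abelian group has at least `m` intervals of
nonzero sum. -/
theorem le_card_interval_sum_ne_zero {G : Type*} [AddCommGroup G] [DecidableEq G] {m : ℕ}
    (u : Fin m → G) (hu : u ≠ 0) :
    m ≤ ((Finset.Icc 1 m ×ˢ Finset.Icc 1 m).filter (fun p => p.1 ≤ p.2 ∧
      ∑ a ∈ Finset.univ.filter (fun a : Fin m => p.1 ≤ (a : ℕ) + 1 ∧ (a : ℕ) + 1 ≤ p.2),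
        u a ≠ 0)).card := by
  let P : ℕ → G := fun t => ∑ a ∈ Finset.univ.filter (fun a : Fin m => (a : ℕ) + 1 ≤ t), u a
  have hP : ∀ i j : ℕ, 1 ≤ i → i ≤ j →
      ∑ a ∈ Finset.univ.filter (fun a : Fin m => i ≤ (a : ℕ) + 1 ∧ (a : ℕ) + 1 ≤ j), u a =
        P j - P (i - 1) := by
    intro i j hi hij
    rw [eq_sub_iff_add_eq]
    simp only [P, Finset.sum_filter, ← Finset.sum_add_distrib]
    refine Finset.sum_congr rfl fun a _ => ?_
    split_ifs <;> first | omega | simp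
  obtain ⟨b, hb, hPb⟩ : ∃ b ≤ m, P b ≠ P 0 := by
    by_contra! h
    refine hu (funext fun a => ?_)
    have h1 := hP (a + 1) (a + 1) (by omega) le_rfl
    rw [h _ a.2, Nat.add_sub_cancel, h _ a.2.le, sub_self] at h1
    have h2 : Finset.univ.filter
        (fun c : Fin m => (a : ℕ) + 1 ≤ (c : ℕ) + 1 ∧ (c : ℕ) + 1 ≤ (a : ℕ) + 1) = {a} := by
      ext c
      simp [Fin.ext_iff]
      omega
    rwa [h2, Finset.sum_singleton] at h1
  refine (le_card_pairs_ne P m b hb hPb).trans (Finset.card_le_card fun p hp => ?_)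
  simp only [Finset.mem_filter, Finset.mem_product, Finset.mem_Icc] at hp ⊢
  refine ⟨hp.1, hp.2.1, ?_⟩
  rw [hP _ _ hp.1.1.1 hp.2.1]
  exact sub_ne_zero.2 hp.2.2

/-- A nonzero `m × m` matrix has at least `m ^ 2` nonzero boxes. -/
theorem sq_le_Nboxes {m q : ℕ} (y : Matrix (Fin m) (Fin m) (ZMod q)) (hy : y ≠ 0) :
    m ^ 2 ≤ Nboxes y := by
  let v : ℕ × ℕ → Fin m → ZMod q := fun p =>
    ∑ a ∈ Finset.univ.filter (fun a : Fin m => p.1 ≤ (a : ℕ) + 1 ∧ (a : ℕ) + 1 ≤ p.2),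
      (y a : Fin m → ZMod q)
  have hbsum : ∀ p r : ℕ × ℕ, bsum y p.1 p.2 r.1 r.2 =
      ∑ c ∈ Finset.univ.filter (fun c : Fin m => r.1 ≤ (c : ℕ) + 1 ∧ (c : ℕ) + 1 ≤ r.2),
        v p c := by
    intro p r
    exact Finset.sum_comm.trans (Finset.sum_congr rfl fun c _ => (Finset.sum_apply c _ _).symm)
  let I := Finset.Icc 1 m ×ˢ Finset.Icc 1 m
  let R := I.filter fun p => p.1 ≤ p.2 ∧ v p ≠ 0
  let C : ℕ × ℕ → Finset (ℕ × ℕ) := fun p => I.filter fun r => r.1 ≤ r.2 ∧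
    ∑ c ∈ Finset.univ.filter (fun c : Fin m => r.1 ≤ (c : ℕ) + 1 ∧ (c : ℕ) + 1 ≤ r.2), v p c ≠ 0
  have hR : m ≤ R.card := le_card_interval_sum_ne_zero (G := Fin m → ZMod q) y hy
  have hC : ∀ p ∈ R, m ≤ (C p).card := fun p hp =>
    le_card_interval_sum_ne_zero (v p) (Finset.mem_filter.1 hp).2.2
  calc m ^ 2 ≤ R.card * m := by rw [sq]; exact Nat.mul_le_mul_right m hR
    _ ≤ ∑ p ∈ R, (C p).card := by
      rw [← smul_eq_mul]; exact Finset.card_nsmul_le_sum R _ m hC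
    _ = (R.sigma C).card := (Finset.card_sigma R C).symm
    _ ≤ Nboxes y := by
      refine Finset.card_le_card_of_injOn (fun x => (x.1, x.2)) ?_ ?_
      · rintro ⟨p, r⟩ h
        simp only [Finset.mem_coe, Finset.mem_sigma, R, C, Finset.mem_filter] at h
        simp only [Finset.mem_coe, Finset.mem_filter, hbsum p r]
        exact ⟨Finset.mem_product.2 ⟨h.1.1, h.2.1⟩, h.1.2.1, h.2.2.1, h.2.2.2⟩
      · rintro ⟨p, r⟩ - ⟨p', r'⟩ - h
        obtain ⟨rfl, rfl⟩ := Prod.mk.inj h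
        rfl

theorem stmt19 (n q : ℕ) (hn : 3 ≤ n) (hq : 2 ≤ q)
    (y : Matrix (Fin (n - 1)) (Fin (n - 1)) (ZMod q)) (hy : y ≠ 0) :
    (n - 1) ^ 2 ≤ Nboxes y := by
  exact sq_le_Nboxes y hy
end
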